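/- Let R be a commutative ring, σ : R → R a ring automorphism, M an R-module, and t : M → M an injective additive map satisfying t(p·m) = σ(p)·t(m) for all p ∈ R and m ∈ M. Then for every integer l ≥ 1, Supp_R(M / t^l(M)) = ⋃_{j=0}^{l−1} σ^j( Supp_R(M / t(M)) ), where Supp_R(−) denotes the set of prime ideals 𝔭 of R at which the localization of the module is nonzero, and where for a prime ideal 𝔭 the prime σ(𝔭) is its image ideal under σ. -/

import Mathlib

noncomputable section

namespace BSpaper

variable {R M : Type*} [CommRing R] [AddCommGroup M] [Module R M]

/-- If `t : M → M` is additive and satisfies `t(p•m) = σ(p)•t(m)`, then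
`t^[l] (p • m) = σ^[l] p • t^[l] m`. -/
lemma iterate_twist (σ : R ≃+* R) (t : M →+ M)
    (ht : ∀ (p : R) (m : M), t (p • m) = σ p • t m) (l : ℕ) :
    ∀ (p : R) (m : M), (⇑t)^[l] (p • m) = (⇑σ)^[l] p • (⇑t)^[l] m := by
  induction l with
  | zero => intro p m; simp
  | succ l ih =>
      intro p m
      rw [Function.iterate_succ_apply, ht, ih (σ p) (t m),
        Function.iterate_succ_apply, Function.iterate_succ_apply]

/-- The image `t^l(M)` of the `l`-fold iterate of `t`, as an `R`-submodule of `M`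
(it is one, thanks to the twisted linearity `t(p•m) = σ(p)•t(m)` and the
surjectivity of `σ`). -/
def twistedImage (σ : R ≃+* R) (t : M →+ M)
    (ht : ∀ (p : R) (m : M), t (p • m) = σ p • t m) (l : ℕ) : Submodule R M where
  carrier := Set.range (⇑t)^[l]
  zero_mem' := ⟨0, by simp⟩
  add_mem' := by
    rintro a b ⟨x, rfl⟩ ⟨y, rfl⟩
    exact ⟨x + y, iterate_map_add t l x y⟩
  smul_mem' := by
    rintro p m ⟨x, rfl⟩
    refine ⟨(⇑σ.symm)^[l] p • x, ?_⟩
    rw [iterate_twist σ t ht l, Function.LeftInverse.iterate σ.apply_symm_apply l p]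

lemma mem_twistedImage (σ : R ≃+* R) (t : M →+ M)
    (ht : ∀ (p : R) (m : M), t (p • m) = σ p • t m) (l : ℕ) (m : M) :
    m ∈ twistedImage σ t ht l ↔ ∃ x, (⇑t)^[l] x = m :=
  Iff.rfl

lemma mem_support_quotient_iff (N : Submodule R M) (p : PrimeSpectrum R) :
    p ∈ Module.support R (M ⧸ N) ↔ ∃ m : M, ∀ r ∉ p.asIdeal, r • m ∉ N := by
  rw [Module.mem_support_iff']
  constructor
  · rintro ⟨m, hm⟩
    obtain ⟨m, rfl⟩ := N.mkQ_surjective m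
    refine ⟨m, fun r hr h => hm r hr ?_⟩
    rwa [← map_smul, Submodule.mkQ_apply, Submodule.Quotient.mk_eq_zero]
  · rintro ⟨m, hm⟩
    refine ⟨N.mkQ m, fun r hr h => hm r hr ?_⟩
    rwa [← map_smul, Submodule.mkQ_apply, Submodule.Quotient.mk_eq_zero] at h

lemma mem_iterate_comap_asIdeal (σ : R →+* R) (l : ℕ) (p : PrimeSpectrum R) (r : R) :
    r ∈ ((PrimeSpectrum.comap σ)^[l] p).asIdeal ↔ (⇑σ)^[l] r ∈ p.asIdeal := by
  induction l generalizing p with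
  | zero => rfl
  | succ l ih =>
    rw [Function.iterate_succ_apply, ih, Function.iterate_succ_apply']
    rfl

lemma image_iterate_comap_symm (σ : R ≃+* R) (l : ℕ) (S : Set (PrimeSpectrum R)) :
    (PrimeSpectrum.comap (σ.symm : R →+* R))^[l] '' S =
      (PrimeSpectrum.comap (σ : R →+* R))^[l] ⁻¹' S := by
  apply congrFun (Set.image_eq_preimage_of_inverse _ _)
  · refine Function.LeftInverse.iterate (fun p => PrimeSpectrum.ext (Ideal.ext fun r => ?_)) l
    exact iff_of_eq (congrArg (· ∈ p.asIdeal) (σ.symm_apply_apply r))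
  · refine Function.RightInverse.iterate (fun p => PrimeSpectrum.ext (Ideal.ext fun r => ?_)) l
    exact iff_of_eq (congrArg (· ∈ p.asIdeal) (σ.apply_symm_apply r))

lemma support_quotient_twistedImage_succ (σ : R ≃+* R) (t : M →+ M)
    (htinj : Function.Injective t) (ht : ∀ (p : R) (m : M), t (p • m) = σ p • t m) (l : ℕ) :
    Module.support R (M ⧸ twistedImage σ t ht (l + 1)) =
      (PrimeSpectrum.comap (σ : R →+* R))^[l] ⁻¹' Module.support R (M ⧸ twistedImage σ t ht 1) ∪
        Module.support R (M ⧸ twistedImage σ t ht l) := by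
  ext p
  simp only [Set.mem_union, Set.mem_preimage, mem_support_quotient_iff,
    mem_iterate_comap_asIdeal, mem_twistedImage, RingEquiv.coe_toRingHom]
  constructor
  · rintro ⟨m, hm⟩
    by_cases h : ∃ r ∉ p.asIdeal, ∃ x, (⇑t)^[l] x = r • m
    · obtain ⟨r, hr, n, hn⟩ := h
      refine .inl ⟨n, ?_⟩
      rintro s hs ⟨x, hx⟩
      refine hm ((⇑σ)^[l] s * r) (fun h => (p.2.mem_or_mem h).elim hs hr) ⟨x, ?_⟩
      rw [mul_smul, ← hn, ← iterate_twist σ t ht, ← hx, Function.iterate_succ_apply,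
        Function.iterate_one]
    · exact .inr ⟨m, fun r hr hx => h ⟨r, hr, hx⟩⟩
  · rintro (⟨n, hn⟩ | ⟨m, hm⟩)
    · refine ⟨(⇑t)^[l] n, ?_⟩
      rintro r hr ⟨x, hx⟩
      obtain ⟨s, rfl⟩ := σ.surjective.iterate l r
      rw [← iterate_twist σ t ht, Function.iterate_succ_apply] at hx
      exact hn s hr ⟨x, htinj.iterate l hx⟩
    · refine ⟨m, ?_⟩
      rintro r hr ⟨x, hx⟩
      exact hm r hr ⟨t x, hx⟩

/-- Let `R` be a commutative ring, `σ : R → R` a ring automorphism,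
`M` an `R`-module and `t : M → M` an injective additive map with `t(p·m) = σ(p)·t(m)`.
Then for every `l ≥ 1`,
`Supp_R(M/t^l(M)) = ⋃_{j=0}^{l-1} σ^j(Supp_R(M/t(M)))`,
where `Supp_R` is the set of primes at which the localization is nonzero and `σ(𝔭)` is
the image ideal of `𝔭` under `σ` (i.e. the preimage under `σ⁻¹`). -/
theorem statement5 (σ : R ≃+* R) (t : M →+ M) (htinj : Function.Injective t)
    (ht : ∀ (p : R) (m : M), t (p • m) = σ p • t m) (l : ℕ) (hl : 1 ≤ l) :
    Module.support R (M ⧸ twistedImage σ t ht l)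
      = ⋃ j ∈ Finset.range l,
          (fun 𝔭 => PrimeSpectrum.comap (σ.symm : R →+* R) 𝔭)^[j] ''
            Module.support R (M ⧸ twistedImage σ t ht 1) := by
  clear hl
  simp only [image_iterate_comap_symm]
  induction l with
  | zero =>
    ext p
    simpa [mem_support_quotient_iff, mem_twistedImage] using ⟨1, p.2.one_notMem⟩
  | succ l ih =>
    rw [support_quotient_twistedImage_succ σ t htinj ht, ih, Finset.range_add_one,
      Finset.set_biUnion_insert]

end BSpaper
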